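/- There exists a constant c (independent of d) such that for every positive integer d there is a deterministic 1-aware population protocol computing the threshold predicate R_d with at most (3/2)·log₂ d + c states. -/

import Mathlib

/-- A population protocol `⟨Q, Q₀, Q₁, q_init, δ⟩` over a set of states `Q`. -/
structure PopulationProtocol (Q : Type) where
  Q0 : Set Q
  Q1 : Set Q
  qinit : Q
  delta : Q → Q → Set (Q × Q)
  union_eq : Q0 ∪ Q1 = Set.univ
  inter_eq : Q0 ∩ Q1 = ∅
  delta_nonempty : ∀ q1 q2 : Q, (delta q1 q2).Nonempty

namespace PopulationProtocol

variable {Q : Type} (P : PopulationProtocol Q)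

/-- A protocol is deterministic if every value of `δ` is a singleton. -/
def Deterministic : Prop := ∀ q1 q2 : Q, ∃ p : Q × Q, P.delta q1 q2 = {p}

/-- The initial `n`-size configuration `I_n`: all agents in the initial state. -/
def initConfig (n : ℕ) : Fin n → Q := fun _ => P.qinit

/-- `(C1, C2)` is a transition: two distinct agents interact according to `δ`,
all other agents keep their state. -/
def Transition {n : ℕ} (C1 C2 : Fin n → Q) : Prop :=
  ∃ i j : Fin n, i ≠ j ∧ (C2 i, C2 j) ∈ P.delta (C1 i) (C1 j) ∧
    ∀ k : Fin n, k ≠ i → k ≠ j → C2 k = C1 k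

/-- `D` is reachable from `C` via a finite sequence of transitions. -/
def Reachable {n : ℕ} (C D : Fin n → Q) : Prop :=
  Relation.ReflTransGen P.Transition C D

/-- An execution: an infinite sequence of configurations starting from `I_n`,
each consecutive pair being a transition. -/
def IsExecution {n : ℕ} (E : ℕ → Fin n → Q) : Prop :=
  E 0 = P.initConfig n ∧ ∀ i : ℕ, P.Transition (E i) (E (i + 1))

/-- Fairness: whenever `C` occurs infinitely often and `D` is reachable from `C`,
`D` also occurs infinitely often. -/
def Fair {n : ℕ} (E : ℕ → Fin n → Q) : Prop :=
  ∀ C D : Fin n → Q, (∀ N : ℕ, ∃ i ≥ N, E i = C) → P.Reachable C D →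
    (∀ N : ℕ, ∃ i ≥ N, E i = D)

/-- `Π` is a 1-aware population protocol computing the predicate `R`. -/
def Computes1Aware (R : ℕ → Bool) : Prop :=
  ∀ n : ℕ, 0 < n →
    (R n = false →
      ∀ C : Fin n → Q, P.Reachable (P.initConfig n) C → ∀ i : Fin n, C i ∈ P.Q0) ∧
    (R n = true →
      ∀ E : ℕ → Fin n → Q, P.IsExecution E → P.Fair E →
        ∃ i0 : ℕ, ∀ i ≥ i0, ∀ a : Fin n, E i a ∈ P.Q1)

/-- A state `q` can occur from a configuration `C`. -/
def CanOccur {n : ℕ} (C : Fin n → Q) (q : Q) : Prop :=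
  ∃ D : Fin n → Q, P.Reachable C D ∧ ∃ i : Fin n, D i = q

/-- `f q`: the minimal `n ∈ ℤ⁺` such that `q` can occur from `I_n`
(`⊤` if there is no such `n`). -/
noncomputable def f (q : Q) : ℕ∞ :=
  sInf {m : ℕ∞ | ∃ n : ℕ, m = (n : ℕ∞) ∧ 0 < n ∧ P.CanOccur (P.initConfig n) q}

/-- `f(Q)`: the set of finite values of `f`. -/
def fQ : Set ℕ := {n : ℕ | ∃ q : Q, P.f q = (n : ℕ∞)}

end PopulationProtocol

/-- The threshold predicate `R_d(n) = 1 ↔ n ≥ d`. -/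
def threshold (d : ℕ) : ℕ → Bool := fun n => decide (d ≤ n)

/-- `e(m)`: the number of `1`s in the binary representation of `m`. -/
def onesCount (m : ℕ) : ℕ := (Nat.digits 2 m).count 1

/-- `z(m)`: the number of `0`s in the binary representation of `m`
(no leading zeros). -/
def zerosCount (m : ℕ) : ℕ := (Nat.digits 2 m).count 0


namespace UB

/-- A set of naturals containing `0, 1, d`, each member `≥ 2` being split into two positive ones. -/
structure ChainData (d : ℕ) where
  S : Finset ℕ
  h0 : 0 ∈ S
  h1 : 1 ∈ S
  hd : d ∈ S
  sp : S → S × S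
  sp_sum : ∀ a : S, 2 ≤ a.1 → (sp a).1.1 + (sp a).2.1 = a.1
  sp_pos : ∀ a : S, 2 ≤ a.1 → 0 < (sp a).1.1 ∧ 0 < (sp a).2.1

variable {d : ℕ} (K : ChainData d)

def step (a b : K.S) : K.S × K.S :=
  if a.1 = d ∨ b.1 = d then (⟨d, K.hd⟩, ⟨d, K.hd⟩)
  else if b.1 = 0 then (if 2 ≤ a.1 then K.sp a else (a, b))
  else if h : a.1 + b.1 ∈ K.S then (⟨a.1 + b.1, h⟩, ⟨0, K.h0⟩)
  else (a, b)

lemma step_sum (a b : K.S) (ha : a.1 ≠ d) (hb : b.1 ≠ d) :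
    (step K a b).1.1 + (step K a b).2.1 = a.1 + b.1 := by
  unfold step
  rw [if_neg (by tauto)]
  split_ifs with h1 h2 h3
  · rw [K.sp_sum a h2, h1]; rfl
  · rfl
  · rfl
  · rfl

lemma step_d (a b : K.S) (h : a.1 = d ∨ b.1 = d) :
    step K a b = (⟨d, K.hd⟩, ⟨d, K.hd⟩) := by
  unfold step
  rw [if_pos h]

lemma step_split (a b : K.S) (ha : a.1 ≠ d) (hb : b.1 ≠ d) (h0 : b.1 = 0) (h2 : 2 ≤ a.1) :
    step K a b = K.sp a := by
  unfold step
  rw [if_neg (by tauto), if_pos h0, if_pos h2]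

lemma step_merge (a b : K.S) (ha : a.1 ≠ d) (hb : b.1 ≠ d) (h0 : b.1 ≠ 0)
    (h : a.1 + b.1 ∈ K.S) :
    step K a b = (⟨a.1 + b.1, h⟩, ⟨0, K.h0⟩) := by
  unfold step
  rw [if_neg (by tauto), if_neg h0, dif_pos h]

def proto : PopulationProtocol K.S where
  Q0 := {a | a.1 ≠ d}
  Q1 := {a | a.1 = d}
  qinit := ⟨1, K.h1⟩
  delta a b := {step K a b}
  union_eq := by ext a; simp; tauto
  inter_eq := by ext a; simp
  delta_nonempty _ _ := Set.singleton_nonempty _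

lemma trans_mk {n : ℕ} (C : Fin n → K.S) (i j : Fin n) (hij : i ≠ j) :
    (proto K).Transition C
      (Function.update (Function.update C i (step K (C i) (C j)).1) j (step K (C i) (C j)).2) := by
  refine ⟨i, j, hij, ?_, ?_⟩
  · simp [proto, Function.update_of_ne hij]
  · intro k hi hj
    simp [hi, hj]

lemma sum_two {n : ℕ} (f g : Fin n → ℕ) (i j : Fin n) (hij : i ≠ j)
    (h : f i + f j = g i + g j) (hk : ∀ k, k ≠ i → k ≠ j → f k = g k) :
    ∑ k, f k = ∑ k, g k := by
  have hj : j ∈ (Finset.univ : Finset (Fin n)).erase i := by simp [hij.symm]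
  rw [← Finset.add_sum_erase _ f (Finset.mem_univ i), ← Finset.add_sum_erase _ f hj,
    ← Finset.add_sum_erase _ g (Finset.mem_univ i), ← Finset.add_sum_erase _ g hj,
    ← add_assoc, ← add_assoc, h]
  congr 1
  apply Finset.sum_congr rfl
  intro k hk'
  simp at hk'
  exact hk k hk'.2 hk'.1

lemma trans_sum {n : ℕ} (C D : Fin n → K.S) (h : (proto K).Transition C D)
    (hC : ∀ i, (C i).1 ≠ d) : ∑ k, (D k).1 = ∑ k, (C k).1 := by
  obtain ⟨i, j, hij, h1, h2⟩ := h
  have h1 : (D i, D j) = step K (C i) (C j) := h1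
  apply sum_two _ _ i j hij
  · have := step_sum K (C i) (C j) (hC i) (hC j)
    rw [← h1] at this
    exact this
  · intro k hi hj
    rw [h2 k hi hj]

lemma trans_d {n : ℕ} (C D : Fin n → K.S) (h : (proto K).Transition C D)
    (k : Fin n) (hC : (C k).1 = d) : (D k).1 = d := by
  obtain ⟨i, j, hij, h1, h2⟩ := h
  have h1 : (D i, D j) = step K (C i) (C j) := h1
  by_cases hi : k = i
  · subst hi
    rw [step_d K _ _ (Or.inl hC)] at h1
    simp at h1
    simp [h1.1]
  · by_cases hj : k = j
    · subst hj
      rw [step_d K _ _ (Or.inr hC)] at h1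
      simp at h1
      simp [h1.2]
    · rw [h2 k hi hj, hC]

lemma inv {n : ℕ} (C : Fin n → K.S) (h : (proto K).Reachable ((proto K).initConfig n) C) :
    (∃ i, (C i).1 = d) ∨ ∑ k, (C k).1 = n := by
  induction h with
  | refl => right; simp [PopulationProtocol.initConfig, proto]
  | tail _ ht ih =>
    rename_i B D _
    by_cases hB : ∃ i, (B i).1 = d
    · obtain ⟨i, hi⟩ := hB
      exact Or.inl ⟨i, trans_d K _ _ ht i hi⟩
    · rcases ih with ih | ih
      · exact absurd ih hB
      · right
        rw [trans_sum K _ _ ht (by simpa using hB), ih]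

lemma no_d {n : ℕ} (C : Fin n → K.S) (hs : ∑ k, (C k).1 = n) (hn : n < d) (i : Fin n) :
    (C i).1 ≠ d := by
  have := Finset.single_le_sum (f := fun k => (C k).1) (fun _ _ => Nat.zero_le _)
    (Finset.mem_univ i)
  omega

lemma safe {n : ℕ} (hn : n < d) (C : Fin n → K.S)
    (h : (proto K).Reachable ((proto K).initConfig n) C) :
    ∑ k, (C k).1 = n := by
  induction h with
  | refl => simp [PopulationProtocol.initConfig, proto]
  | tail _ ht ih => rw [trans_sum K _ _ ht (no_d K _ ih hn), ih]

/-- Some configuration containing `d` is reachable. -/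
def CanD {n : ℕ} (C : Fin n → K.S) : Prop :=
  ∃ D, (proto K).Reachable C D ∧ ∃ i, (D i).1 = d

lemma CanD.of_reach {n : ℕ} {C D : Fin n → K.S} (h : (proto K).Reachable C D) (hD : CanD K D) :
    CanD K C := by
  obtain ⟨F, h1, h2⟩ := hD
  exact ⟨F, Relation.ReflTransGen.trans h h1, h2⟩

lemma spread {n : ℕ} : ∀ (m : ℕ) (C : Fin n → K.S), (∃ i, (C i).1 = d) →
    (Finset.univ.filter (fun i => (C i).1 ≠ d)).card = m →
    (proto K).Reachable C (fun _ => ⟨d, K.hd⟩) := by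
  intro m
  induction m with
  | zero =>
    intro C _ hm
    have : C = fun _ => ⟨d, K.hd⟩ := by
      funext i
      rw [Finset.card_eq_zero, Finset.filter_eq_empty_iff] at hm
      have := hm (Finset.mem_univ i)
      exact Subtype.ext (by simpa using this)
    rw [this]
    exact Relation.ReflTransGen.refl
  | succ m ih =>
    rintro C ⟨i, hi⟩ hm
    obtain ⟨j, hj⟩ : (Finset.univ.filter (fun i => (C i).1 ≠ d)).Nonempty := by
      rw [← Finset.card_pos]; omega
    have hj' : (C j).1 ≠ d := by simpa using hj
    have hij : i ≠ j := by rintro rfl; exact hj' hi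
    have ht := trans_mk K C i j hij
    rw [step_d K _ _ (Or.inl hi)] at ht
    refine Relation.ReflTransGen.head ht (ih _ ⟨j, by simp⟩ ?_)
    have : (Finset.univ.filter (fun k => ((Function.update (Function.update C i ⟨d, K.hd⟩) j
        ⟨d, K.hd⟩) k).1 ≠ d)) = (Finset.univ.filter (fun i => (C i).1 ≠ d)).erase j := by
      ext k
      simp only [Finset.mem_filter, Finset.mem_univ, true_and, Finset.mem_erase]
      by_cases hkj : k = j
      · subst hkj; simp
      · by_cases hki : k = i
        · subst hki; simp [hkj, hi]
        · simp [hkj, hki]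
    simp only at this ⊢
    rw [this, Finset.card_erase_of_mem hj, hm]
    rfl

lemma build {n : ℕ} : ∀ (x : ℕ) (hx : x ∈ K.S), 0 < x → ∀ (C : Fin n → K.S)
    (A : Finset (Fin n)), A.card = x → (∀ i ∈ A, (C i).1 = 1) →
    CanD K C ∨ ∃ D, (proto K).Reachable C D ∧ (∃ i ∈ A, (D i).1 = x) ∧
      ∀ k, k ∉ A → D k = C k := by
  intro x
  induction x using Nat.strong_induction_on with
  | _ x ih =>
  intro hx hx0 C A hA hC
  by_cases h1 : x = 1
  · right
    refine ⟨C, Relation.ReflTransGen.refl, ?_, fun _ _ => rfl⟩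
    obtain ⟨i, hi⟩ : A.Nonempty := by rw [← Finset.card_pos]; omega
    exact ⟨i, hi, by rw [hC i hi, h1]⟩
  · have h2 : 2 ≤ x := by omega
    have hs := K.sp_sum ⟨x, hx⟩ h2
    have hp := K.sp_pos ⟨x, hx⟩ h2
    generalize K.sp ⟨x, hx⟩ = p at hs hp
    obtain ⟨⟨y, hy⟩, ⟨z, hz⟩⟩ := p
    simp only at hs hp
    obtain ⟨B, hBA, hB⟩ := Finset.exists_subset_card_eq (s := A) (n := y) (by omega)
    have hAB : (A \ B).card = z := by
      rw [Finset.card_sdiff_of_subset hBA]; omega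
    rcases ih y (by omega) hy hp.1 C B hB (fun i hi => hC i (hBA hi)) with h | ⟨D, hD, ⟨i, hi, hDi⟩, hk⟩
    · exact Or.inl h
    rcases ih z (by omega) hz hp.2 D (A \ B) hAB (fun i hi => by
      rw [hk i (Finset.mem_sdiff.1 hi).2]; exact hC i (Finset.mem_sdiff.1 hi).1) with
      h | ⟨F, hF, ⟨j, hj, hFj⟩, hk'⟩
    · exact Or.inl (CanD.of_reach K hD h)
    have hFi : (F i).1 = y := by
      rw [hk' i (by simp [hi]), hDi]
    have hr : (proto K).Reachable C F := Relation.ReflTransGen.trans hD hF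
    by_cases hyd : (F i).1 = d
    · exact Or.inl ⟨F, hr, i, hyd⟩
    by_cases hzd : (F j).1 = d
    · exact Or.inl ⟨F, hr, j, hzd⟩
    right
    have hij : i ≠ j := by rintro rfl; exact (Finset.mem_sdiff.1 hj).2 hi
    have ht := trans_mk K F i j hij
    rw [step_merge K _ _ hyd hzd (by omega) (by rw [hFi, hFj, hs]; exact hx)] at ht
    refine ⟨_, Relation.ReflTransGen.tail hr ht, ⟨i, hBA hi, ?_⟩, ?_⟩
    · simp [hij, hFi, hFj, hs]
    · intro k hkA
      have hki : k ≠ i := by rintro rfl; exact hkA (hBA hi)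
      have hkj : k ≠ j := by rintro rfl; exact hkA (Finset.mem_sdiff.1 hj).1
      simp only [Function.update_of_ne hkj, Function.update_of_ne hki]
      rw [hk' k (by simp [hkA]), hk k (fun h => hkA (hBA h))]

lemma back {n : ℕ} (hd0 : 0 < d) (hn : d ≤ n) : ∀ (m : ℕ) (C : Fin n → K.S),
    ∑ k, (C k).1 = n → (Finset.univ.filter (fun i => (C i).1 = 0)).card = m → CanD K C := by
  intro m
  induction m with
  | zero =>
    intro C hs hm
    have h1 : ∀ i, 1 ≤ (C i).1 := by
      intro i
      rw [Finset.card_eq_zero, Finset.filter_eq_empty_iff] at hm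
      have := hm (Finset.mem_univ i)
      omega
    have h2 : ∀ i, (C i).1 = 1 := by
      have := (Finset.sum_eq_sum_iff_of_le (s := Finset.univ) (f := fun _ : Fin n => 1)
        (g := fun i => (C i).1) (fun i _ => h1 i)).1 (by simp [hs])
      intro i
      exact (this i (Finset.mem_univ i)).symm
    obtain ⟨A, -, hA⟩ := Finset.exists_subset_card_eq (s := (Finset.univ : Finset (Fin n)))
      (n := d) (by simpa using hn)
    rcases build K d K.hd hd0 C A hA (fun i _ => h2 i) with h | ⟨D, hD, ⟨i, _, hi⟩, _⟩
    · exact h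
    · exact ⟨D, hD, i, hi⟩
  | succ m ih =>
    intro C hs hm
    by_cases hC : ∃ i, (C i).1 = d
    · exact ⟨C, Relation.ReflTransGen.refl, hC⟩
    push Not at hC
    obtain ⟨j, hj⟩ : (Finset.univ.filter (fun i => (C i).1 = 0)).Nonempty := by
      rw [← Finset.card_pos]; omega
    have hj' : (C j).1 = 0 := by simpa using hj
    obtain ⟨i, hi⟩ : ∃ i, 2 ≤ (C i).1 := by
      by_contra! hcon
      have := Finset.sum_lt_sum (s := Finset.univ) (f := fun i => (C i).1)
        (g := fun _ : Fin n => 1) (fun i _ => by have := hcon i; omega)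
        ⟨j, Finset.mem_univ j, by simp [hj']⟩
      simp [hs] at this
    have hij : i ≠ j := by rintro rfl; omega
    have ht := trans_mk K C i j hij
    have hsum := trans_sum K _ _ ht hC
    rw [step_split K _ _ (hC i) (hC j) hj' hi] at ht hsum
    have hp := K.sp_pos (C i) hi
    refine CanD.of_reach K (Relation.ReflTransGen.single ht) (ih _ (hsum.trans hs) ?_)
    have : (Finset.univ.filter (fun k => ((Function.update (Function.update C i (K.sp (C i)).1) j
        (K.sp (C i)).2) k).1 = 0)) = (Finset.univ.filter (fun i => (C i).1 = 0)).erase j := by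
      ext k
      simp only [Finset.mem_filter, Finset.mem_univ, true_and, Finset.mem_erase]
      by_cases hkj : k = j
      · subst hkj; simp; omega
      · by_cases hki : k = i
        · subst hki; simp only [Function.update_of_ne hkj, Function.update_self]; omega
        · simp [hkj, hki]
    rw [this, Finset.card_erase_of_mem hj, hm]
    rfl

lemma computes (hd0 : 0 < d) : (proto K).Computes1Aware (threshold d) := by
  intro n hn0
  constructor
  · intro hR C hC i
    have hn : n < d := by simpa [threshold] using hR
    exact no_d K C (safe K hn C hC) hn i
  · intro hR E hE hF
    have hn : d ≤ n := by simpa [threshold] using hR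
    have hreach : ∀ i, (proto K).Reachable ((proto K).initConfig n) (E i) := by
      intro i
      induction i with
      | zero => rw [hE.1]; exact Relation.ReflTransGen.refl
      | succ i ih => exact Relation.ReflTransGen.tail ih (hE.2 i)
    obtain ⟨C, hC⟩ := Finite.exists_infinite_fiber E
    have hC' : (E ⁻¹' {C}).Infinite := Set.infinite_coe_iff.1 hC
    have hinf : ∀ N : ℕ, ∃ i ≥ N, E i = C := by
      intro N
      obtain ⟨i, hi, hN⟩ := hC'.exists_gt N
      exact ⟨i, hN.le, hi⟩
    obtain ⟨i1, _, hi1⟩ := hinf 0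
    have hCr := hreach i1
    rw [hi1] at hCr
    have hcan : CanD K C := by
      rcases inv K C hCr with h | h
      · exact ⟨C, Relation.ReflTransGen.refl, h⟩
      · exact back K hd0 hn _ C h rfl
    obtain ⟨D, hD, hDd⟩ := hcan
    have hall : (proto K).Reachable C (fun _ => ⟨d, K.hd⟩) :=
      Relation.ReflTransGen.trans hD (spread K _ D hDd rfl)
    obtain ⟨i0, _, hi0⟩ := hF C _ hinf hall 0
    refine ⟨i0, fun i hi a => ?_⟩
    change (E i a).1 = d
    induction i, hi using Nat.le_induction with
    | base => rw [hi0]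
    | succ i _ ih => exact trans_d K _ _ (hE.2 i) a ih

lemma chain_exists : ∀ d : ℕ, 0 < d → ∃ (S : Finset ℕ) (k : ℕ), {0, 1, 2, 3} ⊆ S ∧ d ∈ S ∧
    (∀ x ∈ S, 2 ≤ x → ∃ y ∈ S, ∃ z ∈ S, 0 < y ∧ 0 < z ∧ y + z = x) ∧
    4 ^ k ≤ d ∧ S.card ≤ 3 * k + 4 := by
  intro d
  induction d using Nat.strong_induction_on with
  | _ d ih =>
  intro hd
  by_cases h4 : d < 4
  · refine ⟨{0, 1, 2, 3}, 0, subset_rfl, ?_, ?_, by rw [pow_zero]; exact hd, by decide⟩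
    · simp; omega
    · intro x hx h2
      refine ⟨1, by simp, x - 1, ?_, by omega, by omega, by omega⟩
      simp at hx ⊢; omega
  · obtain ⟨S, k, h0, hc, hcl, hk, hcard⟩ := ih (d / 4) (by omega) (by omega)
    refine ⟨insert d (insert (4 * (d / 4)) (insert (2 * (d / 4)) S)), k + 1, ?_, by simp, ?_, ?_, ?_⟩
    · intro x hx
      simp only [Finset.mem_insert]
      exact Or.inr (Or.inr (Or.inr (h0 hx)))
    · have h4c : ∃ y ∈ insert d (insert (4 * (d / 4)) (insert (2 * (d / 4)) S)),
          ∃ z ∈ insert d (insert (4 * (d / 4)) (insert (2 * (d / 4)) S)),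
          0 < y ∧ 0 < z ∧ y + z = 4 * (d / 4) :=
        ⟨2 * (d / 4), by simp, 2 * (d / 4), by simp, by omega, by omega, by omega⟩
      intro x hx h2
      rw [Finset.mem_insert, Finset.mem_insert, Finset.mem_insert] at hx
      rcases hx with rfl | rfl | rfl | hx
      · by_cases hr : x % 4 = 0
        · have : 4 * (x / 4) = x := by omega
          rw [this] at h4c ⊢
          exact h4c
        · have hm : x % 4 ∈ S := h0 (by simp; omega)
          exact ⟨4 * (x / 4), by simp, x % 4, by simp [hm], by omega, by omega, by omega⟩
      · exact h4c
      · exact ⟨d / 4, by simp [hc], d / 4, by simp [hc], by omega, by omega, by omega⟩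
      · obtain ⟨y, hy, z, hz, h⟩ := hcl x hx h2
        exact ⟨y, by simp [hy], z, by simp [hz], h⟩
    · rw [pow_succ]; omega
    · have h1 := Finset.card_insert_le d (insert (4 * (d / 4)) (insert (2 * (d / 4)) S))
      have h2 := Finset.card_insert_le (4 * (d / 4)) (insert (2 * (d / 4)) S)
      have h3 := Finset.card_insert_le (2 * (d / 4)) S
      omega

end UB

theorem upper_bound_three_halves :
    ∃ c : ℝ, ∀ d : ℕ, 0 < d →
      ∃ (Q : Type) (inst : Fintype Q) (P : PopulationProtocol Q),
        P.Deterministic ∧ P.Computes1Aware (threshold d) ∧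
        (@Fintype.card Q inst : ℝ) ≤ (3 / 2) * Real.logb 2 d + c := by
  refine ⟨4, fun d hd => ?_⟩
  obtain ⟨S, k, h0, hdS, hcl, hk, hcard⟩ := UB.chain_exists d hd
  have hsp : ∀ a : S, ∃ p : S × S, 2 ≤ a.1 → p.1.1 + p.2.1 = a.1 ∧ (0 < p.1.1 ∧ 0 < p.2.1) := by
    intro a
    by_cases h2 : 2 ≤ a.1
    · obtain ⟨y, hy, z, hz, h1, h2, h3⟩ := hcl a.1 a.2 h2
      exact ⟨(⟨y, hy⟩, ⟨z, hz⟩), fun _ => ⟨h3, h1, h2⟩⟩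
    · exact ⟨(a, a), fun h => absurd h h2⟩
  choose sp hsp using hsp
  let K : UB.ChainData d :=
    { S := S, h0 := h0 (by simp), h1 := h0 (by simp), hd := hdS, sp := sp
      sp_sum := fun a h => (hsp a h).1
      sp_pos := fun a h => (hsp a h).2 }
  refine ⟨K.S, inferInstance, UB.proto K, fun a b => ⟨UB.step K a b, rfl⟩, UB.computes K hd, ?_⟩
  have h1 : (k : ℝ) * 2 ≤ Real.logb 2 d := by
    rw [Real.le_logb_iff_rpow_le (by norm_num) (by exact_mod_cast hd)]
    have : (2 : ℝ) ^ ((k : ℝ) * 2) = ((4 ^ k : ℕ) : ℝ) := by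
      rw [mul_comm, Real.rpow_mul (by norm_num), Real.rpow_natCast]
      push_cast
      norm_num
    rw [this]
    exact_mod_cast hk
  have h2 : ((Fintype.card K.S : ℕ) : ℝ) ≤ 3 * k + 4 := by
    rw [Fintype.card_coe]
    exact_mod_cast hcard
  linarith
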